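/- Drift over a phase of OI. Consider the MMAHH with acceptance operators OI and AM on f = OneMax, with p, q ∈ (0,1), started from an arbitrary x_0 ∈ L_i with i ∈ [0..n] and s_0 = OI. Then E[y_0 − y_{T_s^{(1)}}] = i/(1 + p(n − 1)). -/

import Mathlib

open MeasureTheory
open scoped ENNReal NNReal

namespace MMAHHStmt

/-- The two acceptance operators. -/
inductive Op : Type
  | OI : Op
  | AM : Op
  deriving DecidableEq

instance : MeasurableSpace Op := ⊤

/-- Search points: bit-strings of length `n`. -/
abbrev Point (n : ℕ) := Fin n → Bool

/-- The number of one-bits of a bit-string. -/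
def ones {n : ℕ} (x : Point n) : ℕ := (Finset.univ.filter fun i => x i = true).card

/-- The all-ones string, the global optimum of all benchmarks considered. -/
def optimum (n : ℕ) : Point n := fun _ => true

/-- Flipping the bit in position `v`. -/
def flipBit {n : ℕ} (x : Point n) (v : Fin n) : Point n := Function.update x v (!(x v))

open Classical in
/-- The search point obtained from `x` by proposing to flip bit `v` and applying the
acceptance operator `op` for the objective function `f`. -/
noncomputable def movedPoint {n : ℕ} (f : Point n → ℝ) (op : Op) (x : Point n) (v : Fin n) :
    Point n :=
  match op with
  | Op.OI => if f x < f (flipBit x v) then flipBit x v else x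
  | Op.AM => flipBit x v

open Classical in
/-- One-step transition probability of the search point under acceptance operator `op`:
a uniformly random bit is flipped and the move is accepted or rejected according to `op`. -/
noncomputable def moveProb {n : ℕ} (f : Point n → ℝ) (op : Op) (x x' : Point n) : ℝ≥0∞ :=
  ((Finset.univ.filter fun v => movedPoint f op x v = x').card : ℝ≥0∞) / n

/-- Transition probabilities of the two-state Markov chain on the acceptance operators. -/
noncomputable def switchProb (p q : ℝ) : Op → Op → ℝ≥0∞
  | Op.OI, Op.OI => ENNReal.ofReal (1 - p)
  | Op.OI, Op.AM => ENNReal.ofReal p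
  | Op.AM, Op.OI => ENNReal.ofReal q
  | Op.AM, Op.AM => ENNReal.ofReal (1 - q)

/-- One-step transition probabilities of the MMAHH on the state space
`Point n × Op`: the search point moves according to the current acceptance operator, and,
independently, the operator switches according to the two-state Markov chain. -/
noncomputable def mmahhTrans {n : ℕ} (f : Point n → ℝ) (p q : ℝ) :
    Point n × Op → Point n × Op → ℝ≥0∞ :=
  fun s s' => moveProb f s.2 s.1 s'.1 * switchProb p q s.2 s'.2

/-- `X` is (a version of) the MMAHH Markov chain with objective function `f` and switching
probabilities `p` and `q`, under the measure `μ`: each `X t` is measurable, and conditionally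
on any history, the next state is distributed according to `mmahhTrans`. -/
def IsMMAHH {n : ℕ} {Ω : Type*} [MeasurableSpace Ω] (μ : Measure Ω)
    (X : ℕ → Ω → Point n × Op) (f : Point n → ℝ) (p q : ℝ) : Prop :=
  (∀ t, Measurable (X t)) ∧
  ∀ (t : ℕ) (σ : ℕ → Point n × Op) (s' : Point n × Op),
    μ {ω | (∀ i ≤ t, X i ω = σ i) ∧ X (t + 1) ω = s'}
      = μ {ω | ∀ i ≤ t, X i ω = σ i} * mmahhTrans f p q (σ t) s'

/-- The runtime: the first hitting time of the global optimum, as an extended natural number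
(`⊤` if the optimum is never reached). -/
noncomputable def hitTime {n : ℕ} {Ω : Type*} (X : ℕ → Ω → Point n × Op) (ω : Ω) : ℕ∞ :=
  ⨅ t ∈ {t : ℕ | (X t ω).1 = optimum n}, (t : ℕ∞)

/-- The `k`-th switching time between the two acceptance operators (with junk value given by
`Nat.sInf ∅ = 0` on the probability-zero event that no further switch occurs). -/
noncomputable def switchTime {n : ℕ} {Ω : Type*} (X : ℕ → Ω → Point n × Op) : ℕ → Ω → ℕ
  | 0, _ => 0
  | k + 1, ω =>
      sInf {t : ℕ | switchTime X k ω ≤ t ∧ (X t ω).2 ≠ (X (switchTime X k ω) ω).2}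

/-- The OneMax benchmark. -/
noncomputable def OneMax (n : ℕ) (x : Point n) : ℝ := (ones x : ℝ)

instance instFintypeOp : Fintype Op := ⟨{Op.OI, Op.AM}, fun x => by cases x <;> simp⟩

instance instMSCOp : MeasurableSingletonClass Op := ⟨fun _ => trivial⟩

/-- Number of zero-bits, as a real. -/
noncomputable def zer {n : ℕ} (x : Point n) : ℝ := (n : ℝ) - (ones x : ℝ)

lemma ones_eq_sum {n : ℕ} (x : Point n) : (ones x : ℝ) = ∑ v, if x v = true then (1 : ℝ) else 0 := by
  simp [ones]

lemma ones_flip {n : ℕ} (x : Point n) (v : Fin n) :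
    (ones (flipBit x v) : ℝ) = ones x + (if x v = true then -1 else 1) := by
  rw [ones_eq_sum, ones_eq_sum, ← Finset.add_sum_erase _ _ (Finset.mem_univ v),
    ← Finset.add_sum_erase (Finset.univ) (fun u => if x u = true then (1 : ℝ) else 0)
      (Finset.mem_univ v)]
  have : ∑ u ∈ Finset.univ.erase v, (if flipBit x v u = true then (1 : ℝ) else 0)
      = ∑ u ∈ Finset.univ.erase v, (if x u = true then (1 : ℝ) else 0) := by
    apply Finset.sum_congr rfl
    intro u hu
    simp [flipBit, Function.update_of_ne (Finset.ne_of_mem_erase hu)]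
  rw [this]
  cases h : x v
  · simp [flipBit, h]
    ring
  · simp [flipBit, h]

lemma zer_moved {n : ℕ} (x : Point n) (v : Fin n) :
    zer (movedPoint (OneMax n) Op.OI x v) = zer x - (1 - if x v = true then 1 else 0) := by
  unfold movedPoint OneMax zer
  have := ones_flip x v
  cases h : x v
  · simp [h] at this
    simp [this]
    ring
  · simp [h] at this
    simp only [this]
    rw [if_neg (by linarith)]
    simp

lemma sum_zer_moved {n : ℕ} (x : Point n) :
    ∑ v, zer (movedPoint (OneMax n) Op.OI x v) = ((n : ℝ) - 1) * zer x := by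
  simp_rw [zer_moved, Finset.sum_sub_distrib, ← ones_eq_sum]
  simp [zer]
  ring

lemma sum_moveProb {n : ℕ} (x : Point n) (F : Point n → ℝ) :
    ∑ x', (moveProb (OneMax n) Op.OI x x').toReal * F x'
      = (∑ v, F (movedPoint (OneMax n) Op.OI x v)) / n := by
  classical
  have h1 : ∀ x', (moveProb (OneMax n) Op.OI x x').toReal * F x'
      = (∑ v, if movedPoint (OneMax n) Op.OI x v = x' then F x' else 0) / n := by
    intro x'
    unfold moveProb
    rw [← Finset.sum_filter, Finset.sum_const, nsmul_eq_mul, ENNReal.toReal_div]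
    simp only [ENNReal.toReal_natCast]
    rw [div_mul_eq_mul_div]
  simp_rw [h1]
  rw [← Finset.sum_div, Finset.sum_comm]
  simp

/-- The event that the operator has been OI up to time `t`. -/
def EE {n : ℕ} {Ω : Type*} (X : ℕ → Ω → Point n × Op) (t : ℕ) : Set Ω :=
  {ω | ∀ j ≤ t, (X j ω).2 = Op.OI}

section chain
variable {n : ℕ} {p q : ℝ} {Ω : Type} [MeasurableSpace Ω] {μ : Measure Ω}
  {X : ℕ → Ω → Point n × Op}

lemma meas_set (hX : ∀ t, Measurable (X t)) (t : ℕ) (A : Set (Point n × Op)) :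
    MeasurableSet {ω | X t ω ∈ A} := hX t (Set.toFinite A).measurableSet

lemma meas_EE (hX : ∀ t, Measurable (X t)) (t : ℕ) : MeasurableSet (EE X t) := by
  have : EE X t = ⋂ j : ℕ, ⋂ _ : j ≤ t, {ω | X j ω ∈ {s : Point n × Op | s.2 = Op.OI}} := by
    ext ω; simp [EE]
  rw [this]
  exact MeasurableSet.iInter fun j => MeasurableSet.iInter fun _ => meas_set hX j _

lemma markov {f : Point n → ℝ} (hc : IsMMAHH μ X f p q) (t : ℕ) (s s' : Point n × Op) :
    μ ((EE X t ∩ {ω | X t ω = s}) ∩ {ω | X (t+1) ω = s'})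
      = μ (EE X t ∩ {ω | X t ω = s}) * mmahhTrans f p q s s' := by
  classical
  obtain ⟨hX, hh⟩ := hc
  let H : Ω → (Fin (t+1) → Point n × Op) := fun ω j => X j ω
  have hH : Measurable H := measurable_pi_lambda _ fun j => hX j
  let B : Finset (Fin (t+1) → Point n × Op) :=
    Finset.univ.filter fun h => (∀ j, (h j).2 = Op.OI) ∧ h (Fin.last t) = s
  have hB : EE X t ∩ {ω | X t ω = s} = H ⁻¹' (B : Set _) := by
    ext ω
    simp only [EE, B, H, Set.mem_inter_iff, Set.mem_setOf_eq, Set.mem_preimage, Finset.coe_filter,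
      Finset.mem_univ, true_and, Fin.val_last]
    refine and_congr_left fun _ => ⟨fun h j => h j (by omega), fun h j hj => h ⟨j, by omega⟩⟩
  have hms : MeasurableSet {ω | X (t+1) ω = s'} := meas_set hX (t+1) {s'}
  have hsing : ∀ h ∈ B, MeasurableSet (H ⁻¹' {h}) := fun h _ => hH (measurableSet_singleton h)
  rw [hB, ← Measure.restrict_apply' hms, ← sum_measure_preimage_singleton B hsing,
    ← sum_measure_preimage_singleton B hsing, Finset.sum_mul]
  refine Finset.sum_congr rfl fun h hhB => ?_
  rw [Measure.restrict_apply' hms]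
  let σ : ℕ → Point n × Op := fun j => if hj : j < t+1 then h ⟨j, hj⟩ else s
  have hσ : H ⁻¹' {h} = {ω | ∀ i ≤ t, X i ω = σ i} := by
    ext ω
    simp only [Set.mem_preimage, Set.mem_singleton_iff, funext_iff, H, Set.mem_setOf_eq, σ]
    constructor
    · intro g j hj
      rw [dif_pos (by omega)]
      exact g ⟨j, by omega⟩
    · intro g j
      have := g j (by omega)
      rwa [dif_pos j.2] at this
  have hst : σ t = s := by
    have : h (Fin.last t) = s := (Finset.mem_filter.1 hhB).2.2
    simp only [σ, dif_pos (Nat.lt_succ_self t)]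
    exact this
  have := hh t σ s'
  rw [hst] at this
  rw [hσ, ← this]
  rfl

/-- Mass of the search points while still in the OI phase. -/
noncomputable def mm (μ : Measure Ω) (X : ℕ → Ω → Point n × Op) (t : ℕ) (x : Point n) : ℝ :=
  μ.real (EE X t ∩ {ω | X t ω = (x, Op.OI)})

lemma step [IsProbabilityMeasure μ] (hc : IsMMAHH μ X (OneMax n) p q) (t : ℕ)
    (x' : Point n) (o : Op) :
    μ.real (EE X t ∩ {ω | X (t+1) ω = (x', o)})
      = (switchProb p q Op.OI o).toReal *
        ∑ x, mm μ X t x * (moveProb (OneMax n) Op.OI x x').toReal := by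
  classical
  have hX := hc.1
  have hms : MeasurableSet (EE X t ∩ {ω | X (t+1) ω = (x', o)}) :=
    (meas_EE hX t).inter (meas_set hX (t+1) {(x', o)})
  have h1 : μ (EE X t ∩ {ω | X (t+1) ω = (x', o)})
      = ∑ x, μ (EE X t ∩ {ω | X t ω = (x, Op.OI)}) *
        mmahhTrans (OneMax n) p q (x, Op.OI) (x', o) := by
    have h2 : EE X t ∩ {ω | X (t+1) ω = (x', o)} =
        (X t) ⁻¹' ((Finset.univ.map ⟨fun x : Point n => (x, Op.OI),
          Prod.mk_left_injective _⟩ : Finset (Point n × Op)) : Set _) ∩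
        (EE X t ∩ {ω | X (t+1) ω = (x', o)}) := by
      ext ω
      simp only [Set.mem_inter_iff, Set.mem_preimage]
      refine ⟨fun h => ⟨?_, h⟩, fun h => h.2⟩
      have := h.1 t le_rfl
      simp only [Finset.coe_map, Set.mem_image, Function.Embedding.coeFn_mk]
      exact ⟨(X t ω).1, by simp, by rw [← this]⟩
    rw [h2, ← Measure.restrict_apply' hms, ← sum_measure_preimage_singleton _
      (fun y _ => hX t (measurableSet_singleton y)), Finset.sum_map]
    refine Finset.sum_congr rfl fun x _ => ?_
    rw [Measure.restrict_apply' hms, ← markov hc]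
    congr 1
    ext ω
    simp only [Set.mem_inter_iff, Set.mem_preimage, Set.mem_singleton_iff, Set.mem_setOf_eq,
      Function.Embedding.coeFn_mk]
    tauto
  rw [measureReal_def, h1, ENNReal.toReal_sum]
  · rw [Finset.mul_sum]
    refine Finset.sum_congr rfl fun x _ => ?_
    simp only [mmahhTrans, ENNReal.toReal_mul, mm, measureReal_def]
    ring
  · intro x _
    rw [← markov hc]
    exact measure_ne_top _ _

lemma step_sum [IsProbabilityMeasure μ] (hc : IsMMAHH μ X (OneMax n) p q) (t : ℕ)
    (o : Op) (F : Point n → ℝ) :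
    ∑ x', μ.real (EE X t ∩ {ω | X (t+1) ω = (x', o)}) * F x'
      = (switchProb p q Op.OI o).toReal *
        ∑ x, mm μ X t x * ((∑ v, F (movedPoint (OneMax n) Op.OI x v)) / n) := by
  simp_rw [step hc, ← sum_moveProb, Finset.mul_sum, Finset.sum_mul]
  rw [Finset.sum_comm]
  refine Finset.sum_congr rfl fun x _ => Finset.sum_congr rfl fun y _ => by ring

lemma mm_succ (t : ℕ) (x : Point n) :
    mm μ X (t+1) x = μ.real (EE X t ∩ {ω | X (t+1) ω = (x, Op.OI)}) := by
  unfold mm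
  congr 1
  ext ω
  simp only [EE, Set.mem_inter_iff, Set.mem_setOf_eq]
  refine and_congr_left fun h => ⟨fun g j hj => g j (by omega), fun g j hj => ?_⟩
  rcases Nat.lt_or_ge t j with h1 | h1
  · have : j = t+1 := by omega
    rw [this, h]
  · exact g j h1

lemma init [IsProbabilityMeasure μ] (hX : ∀ t, Measurable (X t)) (x0 : Point n)
    (hinit : μ {ω | X 0 ω = (x0, Op.OI)} = 1) (F : Point n → ℝ) :
    ∑ x, mm μ X 0 x * F x = F x0 := by
  classical
  have h0 : ∀ᵐ ω ∂μ, X 0 ω = (x0, Op.OI) :=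
    (mem_ae_iff_prob_eq_one (meas_set hX 0 {(x0, Op.OI)})).2 hinit
  have : ∀ x, mm μ X 0 x = if x = x0 then 1 else 0 := by
    intro x
    unfold mm
    split_ifs with h
    · subst h
      rw [measureReal_def, show μ _ = 1 from ?_]; · simp
      rw [← hinit]
      congr 1
      ext ω
      simp [EE]
      intro h; simp [h]
    · rw [measureReal_def, show μ _ = 0 from ?_]; · simp
      refine measure_mono_null ?_ (ae_iff.1 h0)
      rintro ω ⟨_, h2⟩ h3
      simp only [Set.mem_setOf_eq] at h2
      rw [h3] at h2
      exact h (congrArg Prod.fst h2).symm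
  simp [this]

lemma sum_mm [IsProbabilityMeasure μ] (hn : 2 ≤ n) (hp1 : p < 1)
    (hc : IsMMAHH μ X (OneMax n) p q) (x0 : Point n)
    (hinit : μ {ω | X 0 ω = (x0, Op.OI)} = 1) (t : ℕ) :
    ∑ x, mm μ X t x = (1 - p) ^ t := by
  have hn0 : (n : ℝ) ≠ 0 := by positivity
  induction t with
  | zero => simpa using init hc.1 x0 hinit (fun _ => 1)
  | succ t ih =>
    have := step_sum hc t Op.OI (fun _ => 1)
    simp only [mul_one, Finset.sum_const, Finset.card_univ, Fintype.card_fin, nsmul_eq_mul,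
      div_self hn0] at this
    simp_rw [mm_succ, this, ih, switchProb]
    rw [ENNReal.toReal_ofReal (by linarith)]
    ring

lemma sum_mm_zer [IsProbabilityMeasure μ] (hp1 : p < 1)
    (hc : IsMMAHH μ X (OneMax n) p q) (x0 : Point n)
    (hinit : μ {ω | X 0 ω = (x0, Op.OI)} = 1) (t : ℕ) :
    ∑ x, mm μ X t x * zer x = ((1 - p) * ((n - 1) / n)) ^ t * zer x0 := by
  induction t with
  | zero => simpa using init hc.1 x0 hinit zer
  | succ t ih =>
    have := step_sum hc t Op.OI zer
    simp_rw [sum_zer_moved] at this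
    simp_rw [mm_succ, this, switchProb]
    rw [ENNReal.toReal_ofReal (by linarith), pow_succ, mul_right_comm, ← ih, Finset.sum_mul,
      Finset.mul_sum]
    refine Finset.sum_congr rfl fun x _ => by ring

/-- The event that the phase ends at time `t+1`. -/
def DD (X : ℕ → Ω → Point n × Op) (t : ℕ) : Set Ω :=
  EE X t ∩ {ω | (X (t+1) ω).2 = Op.AM}

lemma meas_DD (hX : ∀ t, Measurable (X t)) (t : ℕ) : MeasurableSet (DD X t) :=
  (meas_EE hX t).inter (meas_set hX (t+1) {s | s.2 = Op.AM})

lemma switch_DD (t : ℕ) (ω : Ω) (h : ω ∈ DD X t) : switchTime X 1 ω = t + 1 := by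
  obtain ⟨h1, h2⟩ := h
  simp only [Set.mem_setOf_eq] at h2
  simp only [switchTime]
  apply le_antisymm
  · apply Nat.sInf_le
    simp [h1 0 (by omega), h2]
  · apply le_csInf
    · exact ⟨t+1, by simp [h1 0 (by omega), h2]⟩
    · rintro u ⟨_, hu⟩
      by_contra hlt
      exact hu (by rw [h1 u (by omega), h1 0 (by omega)])

lemma disj_DD : Pairwise (Function.onFun Disjoint (DD X)) := by
  intro s t hst
  refine Set.disjoint_left.2 fun ω h1 h2 => hst ?_
  have := switch_DD _ _ h1
  have := switch_DD _ _ h2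
  omega

lemma int_DD [IsProbabilityMeasure μ] (hp0 : 0 < p) (hp1 : p < 1)
    (hc : IsMMAHH μ X (OneMax n) p q) (x0 : Point n)
    (hinit : μ {ω | X 0 ω = (x0, Op.OI)} = 1) (t : ℕ) :
    ∫ ω in DD X t, zer (X (switchTime X 1 ω) ω).1 ∂μ
      = p * ((n - 1) / n) * zer x0 * ((1 - p) * ((n - 1) / n)) ^ t := by
  classical
  have hX := hc.1
  rw [setIntegral_congr_fun (g := fun ω => zer (X (t+1) ω).1) (meas_DD hX t)
    (fun ω h => by simp only [switch_DD t ω h])]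
  have hm1 : Measurable (fun ω => (X (t+1) ω).1) := measurable_fst.comp (hX _)
  have h1 := integral_map (μ := μ.restrict (DD X t)) (f := (zer : Point n → ℝ)) hm1.aemeasurable
    (measurable_of_finite _).aestronglyMeasurable
  rw [← h1, integral_fintype (Integrable.of_finite)]
  have h2 : ∀ x, (Measure.map (fun ω => (X (t+1) ω).1) (μ.restrict (DD X t))).real {x}
      = μ.real (EE X t ∩ {ω | X (t+1) ω = (x, Op.AM)}) := by
    intro x
    rw [measureReal_def, Measure.map_apply hm1 (measurableSet_singleton x),
      Measure.restrict_apply (hm1 (measurableSet_singleton x)), measureReal_def]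
    congr 2
    ext ω
    simp only [DD, Set.mem_inter_iff, Set.mem_preimage, Set.mem_singleton_iff, Set.mem_setOf_eq,
      Prod.ext_iff]
    tauto
  simp_rw [h2, smul_eq_mul, step_sum hc, sum_zer_moved, switchProb]
  rw [ENNReal.toReal_ofReal hp0.le, mul_assoc _ (zer x0), mul_comm (zer x0),
    ← sum_mm_zer hp1 hc x0 hinit t, Finset.mul_sum, Finset.mul_sum]
  refine Finset.sum_congr rfl fun x _ => by ring

lemma ae_DD [IsProbabilityMeasure μ] (hn : 2 ≤ n) (hp0 : 0 < p) (hp1 : p < 1)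
    (hc : IsMMAHH μ X (OneMax n) p q) (x0 : Point n)
    (hinit : μ {ω | X 0 ω = (x0, Op.OI)} = 1) :
    ∀ᵐ ω ∂μ, ω ∈ ⋃ t, DD X t := by
  classical
  have hX := hc.1
  have h0 : ∀ᵐ ω ∂μ, X 0 ω = (x0, Op.OI) :=
    (mem_ae_iff_prob_eq_one (meas_set hX 0 {(x0, Op.OI)})).2 hinit
  have hE : ∀ t, μ.real (EE X t) = (1 - p) ^ t := by
    intro t
    rw [← sum_mm hn hp1 hc x0 hinit t]
    unfold mm
    rw [← measureReal_biUnion_finset]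
    · congr 1
      ext ω
      simp only [Set.mem_iUnion, Set.mem_inter_iff, Set.mem_setOf_eq]
      constructor
      · intro h
        exact ⟨(X t ω).1, Finset.mem_univ _, h, by rw [← h t le_rfl]⟩
      · rintro ⟨_, _, h, _⟩
        exact h
    · intro x _ y _ hxy
      refine Set.disjoint_left.2 ?_
      rintro ω ⟨_, h1⟩ ⟨_, h2⟩
      simp only [Set.mem_setOf_eq] at h1 h2
      exact hxy (congrArg Prod.fst (h1.symm.trans h2))
    · intro x _
      exact (meas_EE hX t).inter (meas_set hX t {(x, Op.OI)})
  have hI : μ (⋂ t, EE X t) = 0 := by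
    have hle : ∀ t, μ.real (⋂ t, EE X t) ≤ (1 - p) ^ t := fun t => by
      rw [← hE t]
      exact measureReal_mono (Set.iInter_subset _ t)
    have hlim := tendsto_pow_atTop_nhds_zero_of_lt_one (r := 1 - p) (by linarith) (by linarith)
    have := ge_of_tendsto' hlim hle
    have h3 : μ.real (⋂ t, EE X t) = 0 := le_antisymm this measureReal_nonneg
    exact (measureReal_eq_zero_iff).1 h3
  have hI' : ∀ᵐ ω ∂μ, ω ∉ ⋂ t, EE X t := measure_eq_zero_iff_ae_notMem.1 hI
  filter_upwards [h0, hI'] with ω h1 h2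
  have hex : ∃ j, (X j ω).2 ≠ Op.OI := by
    by_contra hcon
    push Not at hcon
    exact h2 (Set.mem_iInter.2 fun t j _ => hcon j)
  have hs := Nat.find_spec hex
  have hm := fun j => Nat.find_min (m := j) hex
  obtain ⟨k, hk⟩ : ∃ k, Nat.find hex = k := ⟨_, rfl⟩
  rw [hk] at hs
  rw [hk] at hm
  cases k with
  | zero => exact absurd (by rw [h1]) hs
  | succ k =>
    refine Set.mem_iUnion.2 ⟨k, fun j hj => not_not.1 (hm j (by omega)), ?_⟩
    show (X (k+1) ω).2 = Op.AM
    cases h : (X (k+1) ω).2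
    · exact absurd h hs
    · rfl

lemma int_total [IsProbabilityMeasure μ] (hn : 2 ≤ n) (hp0 : 0 < p) (hp1 : p < 1)
    (hc : IsMMAHH μ X (OneMax n) p q) (x0 : Point n)
    (hinit : μ {ω | X 0 ω = (x0, Op.OI)} = 1) :
    Integrable (fun ω => zer (X (switchTime X 1 ω) ω).1) μ ∧
    ∫ ω, zer (X (switchTime X 1 ω) ω).1 ∂μ
      = p * ((n - 1) / n) * zer x0 * (1 - (1 - p) * ((n - 1) / n))⁻¹ := by
  have hX := hc.1
  have hres : μ.restrict (⋃ t, DD X t) = μ :=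
    Measure.restrict_eq_self_of_ae_mem (ae_DD hn hp0 hp1 hc x0 hinit)
  have hint : Integrable (fun ω => zer (X (switchTime X 1 ω) ω).1) μ := by
    have hae : AEStronglyMeasurable (fun ω => zer (X (switchTime X 1 ω) ω).1) μ := by
      rw [← hres, aestronglyMeasurable_iUnion_iff]
      intro t
      have hm1 : Measurable (fun ω => (X (t+1) ω).1) := measurable_fst.comp (hX _)
      have hm2 : Measurable (fun ω => zer (X (t+1) ω).1) := (measurable_of_finite zer).comp hm1
      refine hm2.aestronglyMeasurable.congr ?_
      filter_upwards [ae_restrict_mem (meas_DD hX t)] with ω h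
      rw [switch_DD t ω h]
    refine Integrable.of_bound hae (n : ℝ) (Filter.Eventually.of_forall fun ω => ?_)
    have : ones (X (switchTime X 1 ω) ω).1 ≤ n := by
      unfold ones
      exact (Finset.card_le_univ _).trans (by simp)
    have h3 : (ones (X (switchTime X 1 ω) ω).1 : ℝ) ≤ n := by exact_mod_cast this
    have h4 : (0 : ℝ) ≤ (ones (X (switchTime X 1 ω) ω).1 : ℝ) := by positivity
    rw [Real.norm_eq_abs, abs_le]
    unfold zer
    constructor <;> linarith
  refine ⟨hint, ?_⟩
  have h := integral_iUnion (μ := μ) (s := DD X) (meas_DD hX) disj_DD hint.integrableOn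
  rw [hres] at h
  rw [h]
  simp_rw [int_DD hp0 hp1 hc x0 hinit]
  have hn' : (2 : ℝ) ≤ n := by exact_mod_cast hn
  have hr0 : 0 ≤ ((n : ℝ) - 1) / n := div_nonneg (by linarith) (by linarith)
  have hr1 : ((n : ℝ) - 1) / n ≤ 1 := (div_le_one (by linarith)).2 (by linarith)
  rw [tsum_mul_left, tsum_geometric_of_lt_one (mul_nonneg (by linarith) hr0) (by nlinarith)]

end chain

/-- Drift over a phase of OI on OneMax (Lemma 6 of the paper). -/
theorem drift_oi_phase (n : ℕ) (hn : 2 ≤ n) (p q : ℝ)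
    (hp0 : 0 < p) (hp1 : p < 1) (hq0 : 0 < q) (hq1 : q < 1)
    (i : ℕ) (hi : i ≤ n) (x0 : Point n) (hx0 : n - ones x0 = i)
    (Ω : Type) [MeasurableSpace Ω] (μ : Measure Ω) (X : ℕ → Ω → Point n × Op)
    (hprob : IsProbabilityMeasure μ) (hchain : IsMMAHH μ X (OneMax n) p q)
    (hinit : μ {ω | X 0 ω = (x0, Op.OI)} = 1) :
    ∫ ω, (((n : ℝ) - (ones (X 0 ω).1 : ℝ)) -
        ((n : ℝ) - (ones (X (switchTime X 1 ω) ω).1 : ℝ))) ∂μ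
      = (i : ℝ) / (1 + p * ((n : ℝ) - 1)) := by
  have hX := hchain.1
  have h0 : ∀ᵐ ω ∂μ, X 0 ω = (x0, Op.OI) :=
    (mem_ae_iff_prob_eq_one (meas_set hX 0 {(x0, Op.OI)})).2 hinit
  obtain ⟨hint, hval⟩ := int_total hn hp0 hp1 hchain x0 hinit
  have hle : ones x0 ≤ n := by
    unfold ones
    exact (Finset.card_le_univ _).trans (by simp)
  have hz : zer x0 = i := by
    unfold zer
    rw [← hx0, Nat.cast_sub hle]
  have hcongr : ∫ ω, (((n : ℝ) - (ones (X 0 ω).1 : ℝ)) -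
        ((n : ℝ) - (ones (X (switchTime X 1 ω) ω).1 : ℝ))) ∂μ
      = ∫ ω, (zer x0 - zer (X (switchTime X 1 ω) ω).1) ∂μ := by
    apply integral_congr_ae
    filter_upwards [h0] with ω h
    simp only [h, zer]
  rw [hcongr, integral_sub (integrable_const _) hint, hval, hz]
  simp only [integral_const, probReal_univ, smul_eq_mul, one_mul]
  have hn' : (2 : ℝ) ≤ n := by exact_mod_cast hn
  have hpos : 0 < 1 + p * ((n : ℝ) - 1) := by nlinarith
  have he : 1 - (1 - p) * (((n : ℝ) - 1) / n) = (1 + p * (n - 1)) / n := by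
    field_simp
    ring
  rw [he]
  field_simp
  ring
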